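/- Let X be a node set in an MPDAG G = (V,E) with V' = V∖X, and let (V_1,…,V_k) be the bucket decomposition of V ordered as a partial causal ordering in G. If there is no pair of nodes V ∈ V' and X ∈ X such that X − V is an undirected edge of G, then for every DAG D in [G], every strictly positive discrete observational density f over V consistent with D satisfies: the interventional density obtained from f by truncated factorization with respect to D equals f(v'|do(x)) = ∏_{V_i ⊆ V'} f(v_i | pa(v_i,G)), where the product is over the buckets V_i contained in V' and the values pa(v_i,G) of Pa(V_i,G) are in agreement with x. -/

import Mathlib

open scoped Classical

noncomputable section

/-- A partially directed graph on node type `V`: directed (`dir`) and undirected (`undir`)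
edges, with at most one edge between any two nodes. -/
structure PDG (V : Type) where
  dir : V → V → Prop
  undir : V → V → Prop
  undir_symm : ∀ a b, undir a b → undir b a
  dir_irrefl : ∀ a, ¬ dir a a
  undir_irrefl : ∀ a, ¬ undir a a
  dir_asymm : ∀ a b, dir a b → ¬ dir b a
  dir_not_undir : ∀ a b, dir a b → ¬ undir a b

namespace PDG

variable {V : Type}

/-- Two nodes are adjacent if there is an edge between them. -/
def Adj (G : PDG V) (a b : V) : Prop := G.dir a b ∨ G.dir b a ∨ G.undir a b

/-- No directed cycles. -/
def Acyclic (G : PDG V) : Prop := ∀ a, ¬ Relation.TransGen G.dir a a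

/-- A maximally oriented PDAG (MPDAG): a partially directed graph with no directed
cycles, in which none of the four configurations of Meek's orientation rules occurs
as an induced subgraph. -/
structure IsMPDAG (G : PDG V) : Prop where
  acyclic : G.Acyclic
  meek1 : ∀ a b c, G.dir a b → G.undir b c → G.Adj a c
  meek2 : ∀ a b c, G.dir a b → G.dir b c → ¬ G.undir a c
  meek3 : ∀ i j k l, k ≠ l → G.undir i j → G.undir i k → G.undir i l →
      G.dir k j → G.dir l j → G.Adj k l
  meek4 : ∀ i j k l, G.undir i j → G.undir i k → G.undir i l →
      G.dir j l → G.dir l k → G.Adj j k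

/-- A DAG: only directed edges, no directed cycles. -/
def IsDAG (G : PDG V) : Prop := (∀ a b, ¬ G.undir a b) ∧ G.Acyclic

/-- `⟨a,b,c⟩` is an unshielded collider. -/
def UnshieldedCollider (G : PDG V) (a b c : V) : Prop :=
  a ≠ c ∧ G.dir a b ∧ G.dir c b ∧ ¬ G.Adj a c

/-- `D ∈ [G]` : `D` is a DAG represented by the MPDAG `G`: same adjacencies,
same unshielded colliders, containing every directed edge of `G`. -/
def InClassOf (D G : PDG V) : Prop :=
  IsDAG D ∧ (∀ a b, G.Adj a b ↔ D.Adj a b) ∧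
    (∀ a b c, G.UnshieldedCollider a b c ↔ D.UnshieldedCollider a b c) ∧
    (∀ a b, G.dir a b → D.dir a b)

/-- `p` is a path: a sequence of at least two distinct nodes in which every pair of
successive nodes is adjacent. -/
def IsPath (G : PDG V) (p : List V) : Prop :=
  2 ≤ p.length ∧ p.Nodup ∧ p.Chain' G.Adj

/-- `p` is a path from `a` to `b`. -/
def IsPathFrom (G : PDG V) (p : List V) (a b : V) : Prop :=
  G.IsPath p ∧ p.head? = some a ∧ p.getLast? = some b

/-- `p` is a possibly causal path: no edge `V_i ← V_j` with `i < j` is in `G`. -/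
def PossiblyCausal (G : PDG V) (p : List V) : Prop :=
  G.IsPath p ∧ ∀ i j : Fin p.length, (i : ℕ) < (j : ℕ) → ¬ G.dir (p.get j) (p.get i)

/-- `p` is a causal path: all edges directed towards the endpoint. -/
def IsCausal (G : PDG V) (p : List V) : Prop :=
  2 ≤ p.length ∧ p.Nodup ∧ p.Chain' G.dir

/-- `p` is an undirected path. -/
def IsUndirPath (G : PDG V) (p : List V) : Prop :=
  p ≠ [] ∧ p.Nodup ∧ p.Chain' G.undir

/-- `p` is unshielded: every two nodes at distance two on `p` are nonadjacent. -/
def Unshielded (G : PDG V) (p : List V) : Prop :=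
  ∀ (i : ℕ) (h : i + 2 < p.length),
    ¬ G.Adj (p.get ⟨i, by omega⟩) (p.get ⟨i + 2, h⟩)

/-- `p` is proper w.r.t. the node set `X` : only its first node is in `X`. -/
def ProperFrom (X : Finset V) (p : List V) : Prop :=
  (∃ a ∈ X, p.head? = some a) ∧ ∀ i : Fin p.length, 0 < (i : ℕ) → p.get i ∉ X

/-- the last node of `p` is in `Y`. -/
def EndsIn (Y : Finset V) (p : List V) : Prop := ∃ b ∈ Y, p.getLast? = some b

/-- `p` starts with an undirected edge. -/
def StartsUndirected (G : PDG V) (p : List V) : Prop :=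
  ∃ a b l, p = a :: b :: l ∧ G.undir a b

/-- There is no proper possibly causal path from `X` to `Y` in `G` that starts with
an undirected edge. -/
def NoProperPCUndirStart (G : PDG V) (X Y : Finset V) : Prop :=
  ¬ ∃ p, G.PossiblyCausal p ∧ ProperFrom X p ∧ EndsIn Y p ∧ G.StartsUndirected p

/-- `A` is an undirected connected node set in `G`: every two distinct nodes of `A`
are joined by an undirected path in `G`. -/
def UndirConnected (G : PDG V) (A : Finset V) : Prop :=
  ∀ a ∈ A, ∀ b ∈ A, a ≠ b →
    ∃ p, G.IsUndirPath p ∧ p.head? = some a ∧ p.getLast? = some b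

/-- `B` is a bucket in `D`: a maximal undirected connected subset of `D` in `G`. -/
def Bucket (G : PDG V) (B D : Finset V) : Prop :=
  B.Nonempty ∧ B ⊆ D ∧ G.UndirConnected B ∧
    ∀ B' : Finset V, B ⊆ B' → B' ⊆ D → G.UndirConnected B' → B' = B

section DecEq

variable [DecidableEq V]

/-- `Bs` lists the bucket decomposition of `D`: the listed sets are buckets in `D`,
pairwise disjoint, with union `D`. -/
def IsBucketDecompList (G : PDG V) (D : Finset V) (Bs : List (Finset V)) : Prop :=
  (∀ B ∈ Bs, G.Bucket B D) ∧ (Bs.Pairwise fun B B' => Disjoint B B') ∧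
    Bs.foldr (· ∪ ·) ∅ = D

end DecEq

/-- The listed node sets are totally ordered as a partial causal ordering in `G` :
every edge between an earlier set and a later one points towards the later one. -/
def OrderedDecomp (G : PDG V) (Bs : List (Finset V)) : Prop :=
  ∀ i j : Fin Bs.length, (i : ℕ) < (j : ℕ) →
    ∀ a ∈ Bs.get i, ∀ b ∈ Bs.get j, G.Adj a b → G.dir a b

/-- the node at (interior) position `i` of `p` is a collider on `p`. -/
def ColliderAt (G : PDG V) (p : List V) (i : ℕ) : Prop :=
  ∃ u v w, p[i-1]? = some u ∧ p[i]? = some v ∧ p[i+1]? = some w ∧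
    1 ≤ i ∧ G.dir u v ∧ G.dir w v

/-- the node at (interior) position `i` of `p` is a definite non-collider on `p`. -/
def DefNonColliderAt (G : PDG V) (p : List V) (i : ℕ) : Prop :=
  ∃ u v w, p[i-1]? = some u ∧ p[i]? = some v ∧ p[i+1]? = some w ∧ 1 ≤ i ∧
    (G.dir v u ∨ G.dir v w ∨ (G.undir u v ∧ G.undir v w ∧ ¬ G.Adj u w))

/-- `p` is a definite status path: every interior node is a collider or a definite
non-collider on `p`. -/
def DefiniteStatus (G : PDG V) (p : List V) : Prop :=
  ∀ i : ℕ, 1 ≤ i → i + 1 < p.length → G.ColliderAt p i ∨ G.DefNonColliderAt p i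

/-- `p` is d-connecting given `Z` (in a DAG): every non-collider on `p` is outside
`Z` and every collider on `p` has a descendant in `Z`. -/
def DConnGiven (G : PDG V) (Z : Finset V) (p : List V) : Prop :=
  (∀ i u, 1 ≤ i → i + 1 < p.length → p[i]? = some u → ¬ G.ColliderAt p i → u ∉ Z) ∧
  (∀ i u, G.ColliderAt p i → p[i]? = some u →
    ∃ z ∈ Z, Relation.ReflTransGen G.dir u z)

/-- `A` and `B` are d-separated given `Z` : no path between them is d-connecting
given `Z`. -/
def DSep (G : PDG V) (A B Z : Finset V) : Prop :=
  ∀ p a b, a ∈ A → b ∈ B → G.IsPathFrom p a b → ¬ G.DConnGiven Z p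

/-- `p` is d-connecting given `Z` (definite status version): every definite
non-collider on `p` is outside `Z` and every collider on `p` has a descendant in `Z`. -/
def DConnDS (G : PDG V) (Z : Finset V) (p : List V) : Prop :=
  (∀ i u, G.DefNonColliderAt p i → p[i]? = some u → u ∉ Z) ∧
  (∀ i u, G.ColliderAt p i → p[i]? = some u →
    ∃ z ∈ Z, Relation.ReflTransGen G.dir u z)

/-- `Z` blocks the (definite status) path `p`. -/
def Blocks (G : PDG V) (Z : Finset V) (p : List V) : Prop := ¬ G.DConnDS Z p

/-- `D_{X̄}` : remove all edges into `X`. -/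
def removeInto (D : PDG V) (X : Finset V) : PDG V where
  dir a b := D.dir a b ∧ b ∉ X
  undir := D.undir
  undir_symm := D.undir_symm
  dir_irrefl := fun a h => D.dir_irrefl a h.1
  undir_irrefl := D.undir_irrefl
  dir_asymm := fun a b h h' => D.dir_asymm a b h.1 h'.1
  dir_not_undir := fun a b h => D.dir_not_undir a b h.1

/-- `D_{X̲}` : remove all edges out of `X`. -/
def removeOutOf (D : PDG V) (X : Finset V) : PDG V where
  dir a b := D.dir a b ∧ a ∉ X
  undir := D.undir
  undir_symm := D.undir_symm
  dir_irrefl := fun a h => D.dir_irrefl a h.1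
  undir_irrefl := D.undir_irrefl
  dir_asymm := fun a b h h' => D.dir_asymm a b h.1 h'.1
  dir_not_undir := fun a b h => D.dir_not_undir a b h.1

/-- `w'` is a possible descendant of `w` in `G`. -/
def PossibleDesc (G : PDG V) (w w' : V) : Prop :=
  w = w' ∨ ∃ p, G.PossiblyCausal p ∧ p.head? = some w ∧ p.getLast? = some w'

section Fin

variable [Fintype V] [DecidableEq V]

/-- the parents of the node `v` in `G`. -/
def paFin (G : PDG V) (v : V) : Finset V := Finset.univ.filter fun u => G.dir u v

/-- `Pa(S, G)` : the parents of the node set `S` in `G`, excluding `S` itself. -/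
def PaFin (G : PDG V) (S : Finset V) : Finset V :=
  (Finset.univ.filter fun u => ∃ v ∈ S, G.dir u v) \ S

/-- `a` is an ancestor of `y` within the induced subgraph of `G` on `S`
(every node is an ancestor of itself). -/
def AncestorIn (G : PDG V) (S : Finset V) (a y : V) : Prop :=
  a ∈ S ∧ y ∈ S ∧ Relation.ReflTransGen (fun u v => G.dir u v ∧ u ∈ S ∧ v ∈ S) a y

/-- `An(Y, G_S)` : the ancestors of `Y` in the induced subgraph of `G` on `S`. -/
def AnIn (G : PDG V) (Y S : Finset V) : Finset V :=
  Finset.univ.filter fun a => ∃ y ∈ Y, G.AncestorIn S a y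

/-- `forb(X, Y, G)` for single nodes `X`, `Y` : all possible descendants of nodes
`W ≠ X` lying on a proper possibly causal path from `X` to `Y` in `G`. -/
def Forb (G : PDG V) (X Y : V) : Finset V :=
  Finset.univ.filter fun w' => ∃ w, w ≠ X ∧
    (∃ p, G.PossiblyCausal p ∧ p.head? = some X ∧ p.getLast? = some Y ∧ w ∈ p) ∧
    G.PossibleDesc w w'

end Fin

end PDG

section Density

open PDG

variable {V : Type} [Fintype V] [DecidableEq V] {Ω : Type} [Fintype Ω] [DecidableEq Ω]

/-- the marginal of `f` over the node set `S`, at the values given by `g`. -/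
def margin (f : (V → Ω) → ℝ) (S : Finset V) (g : V → Ω) : ℝ :=
  ∑ h : V → Ω, if ∀ v ∈ S, h v = g v then f h else 0

/-- the conditional density `f(a | b)` of `A` given `B`, at the values given by `g`. -/
def condOn (f : (V → Ω) → ℝ) (A B : Finset V) (g : V → Ω) : ℝ :=
  margin f (A ∪ B) g / margin f B g

/-- `f` is a strictly positive discrete density over `V`. -/
def IsPosDensity (f : (V → Ω) → ℝ) : Prop :=
  (∀ g, 0 < f g) ∧ ∑ g : V → Ω, f g = 1

/-- `f` is consistent with the DAG `D` : it factorizes according to `D`. -/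
def ConsistentWith (f : (V → Ω) → ℝ) (D : PDG V) : Prop :=
  ∀ g, f g = ∏ v : V, condOn f {v} (D.paFin v) g

/-- the interventional density obtained from `f` by truncated factorization with
respect to the DAG `D` under `do(X = x)`, evaluated at `g` (parent values in `X`
are taken in agreement with `x`). -/
def doDens (f : (V → Ω) → ℝ) (D : PDG V) (X : Finset V) (x : V → Ω) (g : V → Ω) : ℝ :=
  ∏ v ∈ Finset.univ \ X, condOn f {v} (D.paFin v) fun u => if u ∈ X then x u else g u

/-- `f(y | do(x))` : the marginal over `Y` of the interventional density obtained
from `f` by truncated factorization with respect to `D`. -/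
def doMargin (f : (V → Ω) → ℝ) (D : PDG V) (X : Finset V) (x : V → Ω)
    (Y : Finset V) (y : V → Ω) : ℝ :=
  ∑ g : V → Ω,
    if (∀ v ∈ X, g v = x v) ∧ (∀ v ∈ Y, g v = y v) then doDens f D X x g else 0

end Density

open PDG

namespace PDG

section Graph

variable {V : Type}

theorem IsUndirPath.reflTransGen {G : PDG V} {p : List V} {a b : V} (hp : G.IsUndirPath p)
    (ha : p.head? = some a) (hb : p.getLast? = some b) : Relation.ReflTransGen G.undir a b := by
  obtain ⟨-, -, hc⟩ := hp
  induction p generalizing a with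
  | nil => simp at ha
  | cons c l ih =>
    obtain rfl : c = a := by simpa using ha
    cases l with
    | nil =>
      obtain rfl : c = b := by simpa using hb
      exact .refl
    | cons d l =>
      have hc' := List.isChain_cons_cons.1 hc
      exact .head hc'.1 (ih rfl (by simpa using hb) hc'.2)

theorem exists_isUndirPath {G : PDG V} {a b : V} (h : Relation.ReflTransGen G.undir a b) :
    ∃ p, G.IsUndirPath p ∧ p.head? = some a ∧ p.getLast? = some b := by
  induction h with
  | refl => exact ⟨[a], ⟨by simp, by simp, List.isChain_singleton _⟩, rfl, rfl⟩
  | @tail b c _ hbc ih =>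
    obtain ⟨p, ⟨hne, hnd, hch⟩, hh, hl⟩ := ih
    by_cases hc : c ∈ p
    · obtain ⟨l₁, l₂, rfl⟩ := List.append_of_mem hc
      have hpre : l₁ ++ [c] <+: l₁ ++ c :: l₂ := ⟨l₂, by simp⟩
      refine ⟨l₁ ++ [c], ⟨by simp, hnd.sublist hpre.sublist, (List.isChain_split.1 hch).1⟩, ?_,
        by simp⟩
      cases l₁ <;> simpa using hh
    · refine ⟨p ++ [c], ⟨by simp, ?_, ?_⟩, ?_, by simp⟩
      · exact List.nodup_append.2 ⟨hnd, List.nodup_singleton c, fun x hx y hy hxy =>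
          hc (List.mem_singleton.1 hy ▸ hxy ▸ hx)⟩
      · refine List.IsChain.append hch (by simp) ?_
        intro x hx y hy
        obtain rfl : b = x := by simpa [hl] using hx
        obtain rfl : c = y := by simpa using hy
        exact hbc
      · simp [List.head?_append, hh]

theorem undirConnected_iff {G : PDG V} {A : Finset V} :
    G.UndirConnected A ↔ ∀ a ∈ A, ∀ b ∈ A, Relation.ReflTransGen G.undir a b := by
  constructor
  · intro h a ha b hb
    by_cases hab : a = b
    · exact hab ▸ .refl
    · obtain ⟨p, hp, h₁, h₂⟩ := h a ha b hb hab
      exact hp.reflTransGen h₁ h₂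
  · exact fun h a ha b hb _ => exists_isUndirPath (h a ha b hb)

variable [DecidableEq V]

theorem mem_foldr_union {l : List (Finset V)} {v : V} :
    v ∈ l.foldr (· ∪ ·) ∅ ↔ ∃ B ∈ l, v ∈ B := by
  induction l with
  | nil => simp
  | cons B l ih => simp [ih]

theorem prod_foldr_union {l : List (Finset V)} (hl : l.Pairwise fun B B' => Disjoint B B')
    (k : V → ℝ) : ∏ v ∈ l.foldr (· ∪ ·) ∅, k v = (l.map fun B => ∏ v ∈ B, k v).prod := by
  induction l with
  | nil => simp
  | cons B l ih =>
    obtain ⟨h₁, h₂⟩ := List.pairwise_cons.1 hl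
    rw [List.map_cons, List.prod_cons, List.foldr_cons, Finset.prod_union, ih h₂]
    rw [Finset.disjoint_left]
    intro v hv hv'
    obtain ⟨B', hB', hvB'⟩ := mem_foldr_union.1 hv'
    exact Finset.disjoint_left.1 (h₁ B' hB') hv hvB'

variable [Fintype V]

theorem Bucket.mem_of_undir {G : PDG V} {B : Finset V} (hB : G.Bucket B Finset.univ)
    {b c : V} (hb : b ∈ B) (h : G.undir b c) : c ∈ B := by
  obtain ⟨-, -, hcon, hmax⟩ := hB
  rw [undirConnected_iff] at hcon
  have key : insert c B = B := by
    refine hmax _ (Finset.subset_insert _ _) (Finset.subset_univ _) (undirConnected_iff.2 ?_)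
    intro u hu v hv
    rcases Finset.mem_insert.1 hu with rfl | huB <;> rcases Finset.mem_insert.1 hv with rfl | hvB
    · exact .refl
    · exact .head (G.undir_symm _ _ h) (hcon _ hb _ hvB)
    · exact .tail (hcon _ huB _ hb) h
    · exact hcon _ huB _ hvB
  exact key ▸ Finset.mem_insert_self c B

/-- A parent of one node of a bucket, lying outside the bucket, is a parent of every node
of the bucket. -/
theorem Bucket.dir_of_dir {G : PDG V} (hG : G.IsMPDAG) {B : Finset V}
    (hB : G.Bucket B Finset.univ) {p b c : V} (hp : p ∉ B) (hb : b ∈ B) (hc : c ∈ B)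
    (h : G.dir p b) : G.dir p c := by
  have hbc := undirConnected_iff.1 hB.2.2.1 b hb c hc
  clear hc
  suffices c ∈ B ∧ G.dir p c from this.2
  induction hbc with
  | refl => exact ⟨hb, h⟩
  | @tail u v _ huv ih =>
    obtain ⟨hu, hpu⟩ := ih
    have hv := hB.mem_of_undir hu huv
    refine ⟨hv, ?_⟩
    rcases hG.meek1 p u v hpu huv with h₁ | h₁ | h₁
    · exact h₁
    · exact absurd (G.undir_symm _ _ huv) (hG.meek2 v p u h₁ hpu)
    · exact absurd (hB.mem_of_undir hv (G.undir_symm _ _ h₁)) hp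

theorem Bucket.paFin_eq {G D : PDG V} (hG : G.IsMPDAG) (hD : D.InClassOf G) {B : Finset V}
    (hB : G.Bucket B Finset.univ) {v : V} (hv : v ∈ B) :
    D.paFin v = G.PaFin B ∪ (D.paFin v ∩ B) := by
  obtain ⟨-, hadj, -, hdir⟩ := hD
  ext u
  simp only [paFin, PaFin, Finset.mem_union, Finset.mem_inter, Finset.mem_sdiff,
    Finset.mem_filter, Finset.mem_univ, true_and]
  constructor
  · intro h
    by_cases hu : u ∈ B
    · exact .inr ⟨h, hu⟩
    · refine .inl ⟨⟨v, hv, ?_⟩, hu⟩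
      rcases (hadj u v).2 (.inl h) with h₁ | h₁ | h₁
      · exact h₁
      · exact absurd (hdir _ _ h₁) (D.dir_asymm _ _ h)
      · exact absurd (hB.mem_of_undir hv (G.undir_symm _ _ h₁)) hu
  · rintro (⟨⟨w, hw, h⟩, hu⟩ | h)
    · exact hdir _ _ (hB.dir_of_dir hG hu hw hv h)
    · exact h.1

/-- If no undirected edge leaves `X`, a bucket meeting `X` is contained in `X`. -/
theorem Bucket.subset_of_mem {G : PDG V} {B X : Finset V} (hB : G.Bucket B Finset.univ)
    (hX : ¬ ∃ x' ∈ X, ∃ v ∈ Finset.univ \ X, G.undir x' v) {a : V} (haB : a ∈ B)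
    (haX : a ∈ X) : B ⊆ X := by
  intro b hb
  have hab := undirConnected_iff.1 hB.2.2.1 a haB b hb
  clear hb
  induction hab with
  | refl => exact haX
  | @tail u v _ huv ih =>
    by_contra hv
    exact hX ⟨u, ih, v, by simpa using hv, huv⟩

/-- `S` contains every parent in `D` of each of its nodes. -/
def Ancestral (D : PDG V) (S : Finset V) : Prop := ∀ v ∈ S, D.paFin v ⊆ S

/-- The union of the buckets at positions below `n` is ancestral in every represented DAG. -/
theorem ancestral_take {G D : PDG V} (hD : D.InClassOf G) {Vs : List (Finset V)}
    (hdec : G.IsBucketDecompList Finset.univ Vs) (hord : G.OrderedDecomp Vs) (n : ℕ) :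
    D.Ancestral ((Vs.take n).foldr (· ∪ ·) ∅) := by
  intro v hv u hu
  have huv : D.dir u v := by simpa [paFin] using hu
  rw [mem_foldr_union] at hv ⊢
  obtain ⟨B, hB, hvB⟩ := hv
  obtain ⟨i, hi, rfl⟩ := List.mem_take_iff_getElem.1 hB
  have hu' : u ∈ Vs.foldr (· ∪ ·) ∅ := by rw [hdec.2.2]; exact Finset.mem_univ u
  obtain ⟨B', hB', huB'⟩ := mem_foldr_union.1 hu'
  obtain ⟨j, hj, rfl⟩ := List.mem_iff_getElem.1 hB'
  have hin : i < n ∧ i < Vs.length := by simpa using hi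
  rcases lt_or_ge i j with hij | hij
  · have hvu := hord ⟨i, hin.2⟩ ⟨j, hj⟩ hij v hvB u huB' ((hD.2.1 v u).2 (.inr (.inl huv)))
    exact absurd (hD.2.2.2 _ _ hvu) (D.dir_asymm _ _ huv)
  · exact ⟨_, List.mem_take_iff_getElem.2 ⟨j, by simp; omega, rfl⟩, huB'⟩

theorem Acyclic.exists_paFin_subset {D : PDG V} (hD : D.Acyclic) {S : Finset V}
    (hne : S ≠ Finset.univ) : ∃ v ∉ S, D.paFin v ⊆ S := by
  have : IsTrans V (Relation.TransGen D.dir) := ⟨fun _ _ _ => Relation.TransGen.trans⟩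
  have : Std.Irrefl (Relation.TransGen D.dir) := ⟨hD⟩
  have hwf := Finite.wellFounded_of_trans_of_irrefl (Relation.TransGen D.dir)
  obtain ⟨w, hw⟩ : ∃ w, w ∉ S := by
    by_contra! h
    exact hne (Finset.eq_univ_iff_forall.2 h)
  obtain ⟨v, hv, hmin⟩ := hwf.has_min {v | v ∉ S} ⟨w, hw⟩
  refine ⟨v, hv, fun u hu => ?_⟩
  by_contra huS
  exact hmin u huS (.single (by simpa [paFin] using hu))

end Graph

end PDG

section Margin

variable {V : Type} [Fintype V] [DecidableEq V] {Ω : Type} [Fintype Ω] [DecidableEq Ω]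

theorem margin_congr (f : (V → Ω) → ℝ) {S : Finset V} {g g' : V → Ω}
    (h : ∀ v ∈ S, g v = g' v) : margin f S g = margin f S g' := by
  refine Finset.sum_congr rfl fun w _ => ?_
  have : (∀ v ∈ S, w v = g v) ↔ ∀ v ∈ S, w v = g' v :=
    forall₂_congr fun v hv => by rw [h v hv]
  simp only [this]

theorem margin_update (f : (V → Ω) → ℝ) {S : Finset V} {v : V} (hv : v ∉ S) (g : V → Ω) (a : Ω) :
    margin f S (Function.update g v a) = margin f S g :=
  margin_congr f fun u hu => Function.update_of_ne (by rintro rfl; exact hv hu) _ _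

theorem sum_margin_insert (f : (V → Ω) → ℝ) {S : Finset V} {v : V} (hv : v ∉ S) (g : V → Ω) :
    ∑ a, margin f (insert v S) (Function.update g v a) = margin f S g := by
  unfold margin
  rw [Finset.sum_comm]
  refine Finset.sum_congr rfl fun h _ => ?_
  have key : ∀ a, (∀ u ∈ insert v S, h u = Function.update g v a u) ↔
      h v = a ∧ ∀ u ∈ S, h u = g u := by
    intro a
    rw [Finset.forall_mem_insert, Function.update_self]
    refine and_congr_right fun _ => forall₂_congr fun u hu => ?_
    rw [Function.update_of_ne (by rintro rfl; exact hv hu)]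
  simp only [key, ite_and, Finset.sum_ite_eq, Finset.mem_univ, if_true]

theorem margin_univ (f : (V → Ω) → ℝ) (g : V → Ω) : margin f Finset.univ g = f g := by
  simp [margin, ← funext_iff]

theorem IsPosDensity.margin_pos {f : (V → Ω) → ℝ} (hf : IsPosDensity f) (S : Finset V)
    (g : V → Ω) : 0 < margin f S g := by
  refine Finset.sum_pos' (fun h _ => ?_) ⟨g, Finset.mem_univ g, ?_⟩
  · split_ifs
    exacts [(hf.1 h).le, le_rfl]
  · simpa using hf.1 g

theorem condOn_congr (f : (V → Ω) → ℝ) {A B : Finset V} {g g' : V → Ω}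
    (h : ∀ v ∈ A ∪ B, g v = g' v) : condOn f A B g = condOn f A B g' := by
  unfold condOn
  rw [margin_congr f h, margin_congr f fun v hv => h v (Finset.mem_union_right _ hv)]

theorem IsPosDensity.sum_condOn {f : (V → Ω) → ℝ} (hf : IsPosDensity f) {S : Finset V} {v : V}
    (hv : v ∉ S) (g : V → Ω) : ∑ a, condOn f {v} S (Function.update g v a) = 1 := by
  simp only [condOn, margin_update f hv]
  rw [← Finset.sum_div, ← Finset.insert_eq, sum_margin_insert f hv]
  exact div_self (hf.margin_pos S g).ne'

/-- The marginal over an ancestral set factorizes. -/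
theorem ConsistentWith.margin_eq_prod {f : (V → Ω) → ℝ} {D : PDG V} (hcons : ConsistentWith f D)
    (hf : IsPosDensity f) (hD : D.Acyclic) {S : Finset V} (hS : D.Ancestral S) (g : V → Ω) :
    margin f S g = ∏ v ∈ S, condOn f {v} (D.paFin v) g := by
  induction hn : Sᶜ.card generalizing S g with
  | zero =>
    obtain rfl : S = Finset.univ := by simpa using hn
    rw [margin_univ, hcons g]
  | succ n ih =>
    obtain ⟨v, hv, hpa⟩ := hD.exists_paFin_subset (S := S) (by rintro rfl; simp at hn)
    have hS' : D.Ancestral (insert v S) := by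
      intro u hu
      rcases Finset.mem_insert.1 hu with rfl | hu
      · exact hpa.trans (Finset.subset_insert _ _)
      · exact (hS u hu).trans (Finset.subset_insert _ _)
    have hcard : (insert v S)ᶜ.card = n := by
      rw [Finset.compl_insert, Finset.card_erase_of_mem (by simpa using hv), hn]; rfl
    have hprod : ∀ a, ∏ u ∈ S, condOn f {u} (D.paFin u) (Function.update g v a) =
        ∏ u ∈ S, condOn f {u} (D.paFin u) g := fun a =>
      Finset.prod_congr rfl fun u hu => condOn_congr f fun w hw =>
        Function.update_of_ne (by
          rintro rfl
          rcases Finset.mem_union.1 hw with hw | hw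
          · exact hv (Finset.mem_singleton.1 hw ▸ hu)
          · exact hv (hS u hu hw)) _ _
    rw [← sum_margin_insert f hv]
    simp only [fun g => ih hS' g hcard, Finset.prod_insert hv, hprod]
    rw [← Finset.sum_mul, hf.sum_condOn (fun h => hv (hpa h)), one_mul]

/-- If the factor `K` relating the marginals over `A` and `B ∪ A` depends only on the values in
`B ∪ P` with `P ⊆ A`, it also relates the marginals over `P` and `B ∪ P`. -/
theorem margin_union_eq_mul_of_subset (f K : (V → Ω) → ℝ) {A B P : Finset V}
    (hPA : P ⊆ A) (hAB : Disjoint A B)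
    (hK : ∀ g g' : V → Ω, (∀ v ∈ B ∪ P, g v = g' v) → K g = K g')
    (h : ∀ g, margin f (B ∪ A) g = K g * margin f A g) (g : V → Ω) :
    margin f (B ∪ P) g = K g * margin f P g := by
  induction hn : (A \ P).card generalizing A with
  | zero =>
    obtain rfl : A = P :=
      (Finset.sdiff_eq_empty_iff_subset.1 (Finset.card_eq_zero.1 hn)).antisymm hPA
    exact h g
  | succ n ih =>
    obtain ⟨v, hv⟩ := Finset.card_pos.1 (by omega : 0 < (A \ P).card)
    obtain ⟨hvA, hvP⟩ := Finset.mem_sdiff.1 hv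
    have hvB := Finset.disjoint_left.1 hAB hvA
    refine ih (A := A.erase v) (Finset.subset_erase.2 ⟨hPA, hvP⟩)
      (hAB.mono_left (Finset.erase_subset _ _)) (fun g => ?_) ?_
    · have hvU : v ∉ B ∪ A.erase v := by simp [hvB]
      rw [← sum_margin_insert f hvU, ← Finset.union_insert, Finset.insert_erase hvA,
        ← sum_margin_insert f (Finset.notMem_erase v A), Finset.insert_erase hvA, Finset.mul_sum]
      refine Finset.sum_congr rfl fun a _ => ?_
      rw [h, hK (Function.update g v a) g fun u hu => Function.update_of_ne ?_ _ _]
      rintro rfl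
      exact (Finset.mem_union.1 hu).elim hvB hvP
    · rw [Finset.erase_sdiff_comm, Finset.card_erase_of_mem hv, hn]; rfl

/-- The factors of the nodes of a bucket multiply to the conditional density of the bucket
given its parents. -/
theorem prod_condOn_bucket {G D : PDG V} (hG : G.IsMPDAG) (hD : D.InClassOf G)
    {f : (V → Ω) → ℝ} (hf : IsPosDensity f) (hcons : ConsistentWith f D) {A B : Finset V}
    (hB : G.Bucket B Finset.univ) (hAB : Disjoint A B) (hA : D.Ancestral A)
    (hBA : D.Ancestral (B ∪ A)) (g : V → Ω) :
    ∏ v ∈ B, condOn f {v} (D.paFin v) g = condOn f B (G.PaFin B) g := by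
  have hPA : G.PaFin B ⊆ A := by
    intro u hu
    obtain ⟨b, hb⟩ := hB.1
    have h₁ : u ∈ D.paFin b := by
      rw [hB.paFin_eq hG hD hb]
      exact Finset.mem_union_left _ hu
    exact (Finset.mem_union.1 (hBA b (Finset.mem_union_left _ hb) h₁)).resolve_left
      (Finset.mem_sdiff.1 hu).2
  rw [condOn, eq_div_iff (hf.margin_pos _ g).ne']
  refine (margin_union_eq_mul_of_subset f (fun g => ∏ v ∈ B, condOn f {v} (D.paFin v) g)
    hPA hAB (fun g g' h => ?_) (fun g => ?_) g).symm
  · refine Finset.prod_congr rfl fun v hv => condOn_congr f fun u hu => h u ?_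
    rw [hB.paFin_eq hG hD hv] at hu
    simp only [Finset.mem_union, Finset.mem_inter, Finset.mem_singleton] at hu ⊢
    rcases hu with rfl | hu | hu
    exacts [.inl hv, .inr hu, .inl hu.2]
  · rw [hcons.margin_eq_prod hf hD.1.2 hBA, hcons.margin_eq_prod hf hD.1.2 hA,
      Finset.prod_union hAB.symm]

end Margin

/-- truncated factorization formula in MPDAGs. -/
theorem stmt4 {V : Type} [Fintype V] [DecidableEq V]
    {Ω : Type} [Fintype Ω] [DecidableEq Ω]
    (G : PDG V) (hG : G.IsMPDAG) (X : Finset V)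
    (Vs : List (Finset V)) (hk : Vs ≠ [])
    (hdec : G.IsBucketDecompList Finset.univ Vs) (hord : G.OrderedDecomp Vs)
    (hnoundir : ¬ ∃ x' ∈ X, ∃ v ∈ Finset.univ \ X, G.undir x' v)
    (D : PDG V) (hD : D.InClassOf G)
    (f : (V → Ω) → ℝ) (hf : IsPosDensity f) (hcons : ConsistentWith f D)
    (x g : V → Ω) (hg : ∀ v ∈ X, g v = x v) :
    doDens f D X x g =
      (Vs.map fun Vi =>
        if Vi ⊆ Finset.univ \ X then condOn f Vi (G.PaFin Vi) g else 1).prod := by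
  have hval : (fun u => if u ∈ X then x u else g u) = g := by
    funext u
    split_ifs with hu
    exacts [(hg u hu).symm, rfl]
  have hlhs : doDens f D X x g =
      ∏ v ∈ Vs.foldr (· ∪ ·) ∅, if v ∈ X then 1 else condOn f {v} (D.paFin v) g := by
    rw [hdec.2.2, doDens, hval, Finset.prod_ite, Finset.prod_const_one, one_mul,
      Finset.sdiff_eq_filter]
  rw [hlhs, prod_foldr_union hdec.2.1]
  congr 1
  refine List.map_congr_left fun B hBmem => ?_
  have hB := hdec.1 B hBmem
  split_ifs with hsub
  · obtain ⟨n, hn, rfl⟩ := List.mem_iff_getElem.1 hBmem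
    have hunion : Vs[n] ∪ (Vs.take n).foldr (· ∪ ·) ∅ = (Vs.take (n + 1)).foldr (· ∪ ·) ∅ := by
      ext v
      rw [Finset.mem_union, mem_foldr_union, mem_foldr_union, List.take_succ_eq_append_getElem hn]
      simp only [List.mem_append, List.mem_singleton, or_and_right, exists_or, exists_eq_left]
      exact or_comm
    rw [← prod_condOn_bucket hG hD hf hcons (A := (Vs.take n).foldr (· ∪ ·) ∅) hB ?_
      (ancestral_take hD hdec hord n) (hunion ▸ ancestral_take hD hdec hord (n + 1))]
    · exact Finset.prod_congr rfl fun v hv => if_neg (Finset.mem_sdiff.1 (hsub hv)).2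
    · rw [Finset.disjoint_left]
      intro v hv
      obtain ⟨B, hBt, hvB⟩ := mem_foldr_union.1 hv
      obtain ⟨i, hi, rfl⟩ := List.mem_take_iff_getElem.1 hBt
      have hin : i < n ∧ i < Vs.length := by simpa using hi
      exact Finset.disjoint_left.1
        (List.pairwise_iff_getElem.1 hdec.2.1 i n hin.2 hn hin.1) hvB
  · obtain ⟨a, haB, haX⟩ := Finset.not_subset.1 hsub
    have hBX := hB.subset_of_mem hnoundir haB (by simpa using haX)
    exact Finset.prod_eq_one fun v hv => if_pos (hBX hv)
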